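/- Let S ⊆ ℝ² be a bounded measurable set of two-dimensional Lebesgue measure A > 0. Then the one-dimensional Hausdorff measure of the topological frontier of S satisfies μH¹(frontier S) ≥ 2·√(π·A); moreover, if S is an open disc of radius √(A/π), then μH¹(frontier S) = 2·√(π·A). -/

import Mathlib

open MeasureTheory


abbrev E2 := EuclideanSpace ℝ (Fin 2)

noncomputable def cel (n : ℕ) (x : E2) : ℤ × ℤ := (⌊((n:ℝ)+1) * x 0⌋, ⌊((n:ℝ)+1) * x 1⌋)

lemma cel_meas (n : ℕ) : Measurable (cel n) := by
  unfold cel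
  have h0 : Measurable (fun x : E2 => x 0) := by fun_prop
  have h1 : Measurable (fun x : E2 => x 1) := by fun_prop
  exact (Int.measurable_floor.comp (h0.const_mul _)).prodMk (Int.measurable_floor.comp (h1.const_mul _))

lemma cel_dist (n : ℕ) (x y : E2) (h : cel n x = cel n y) : dist x y ≤ 2 / ((n:ℝ)+1) := by
  unfold cel at h
  rw [Prod.mk.injEq] at h
  have hn : (0:ℝ) < n + 1 := by positivity
  have h0 := Int.abs_sub_lt_one_of_floor_eq_floor h.1
  have h1 := Int.abs_sub_lt_one_of_floor_eq_floor h.2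
  rw [← mul_sub, abs_mul, abs_of_pos hn] at h0 h1
  rw [le_div_iff₀ hn, EuclideanSpace.dist_eq, Fin.sum_univ_two, Real.dist_eq, Real.dist_eq]
  have : √(|x 0 - y 0| ^ 2 + |x 1 - y 1| ^ 2) ≤ |x 0 - y 0| + |x 1 - y 1| := by
    apply Real.sqrt_le_iff.2
    constructor
    · positivity
    · nlinarith [abs_nonneg (x 0 - y 0), abs_nonneg (x 1 - y 1), mul_nonneg (abs_nonneg (x 0 - y 0)) (abs_nonneg (x 1 - y 1))]
  nlinarith

lemma cel_small (x : E2) (ε : ℝ) (hε : 0 < ε) : ∀ᶠ n in Filter.atTop, ∀ y, cel n y = cel n x → dist y x < ε := by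
  have : Filter.Tendsto (fun n : ℕ => 2 * (1 / ((n:ℝ)+1))) Filter.atTop (nhds (2 * 0)) :=
    tendsto_one_div_add_atTop_nhds_zero_nat.const_mul 2
  rw [mul_zero] at this
  filter_upwards [this.eventually_lt_const hε] with n hn y hy
  refine lt_of_le_of_lt (cel_dist n y x hy) ?_
  rwa [mul_one_div] at hn

lemma eil (p : E2 → ℝ) (hp : LipschitzWith 1 p) (G : Set E2) (hG : MeasurableSet G)
    (w : E2 → ENNReal) (hw : Continuous w) :
    ∃ k : ℝ → ENNReal, Measurable k ∧
      (∀ t, (⨆ (F : Finset E2) (_ : ∀ x ∈ F, x ∈ G ∧ p x = t), ∑ x ∈ F, w x) ≤ k t) ∧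
      ∫⁻ t, k t ≤ ∫⁻ x in G, w x ∂μH[1] := by
  classical
  set m : ℕ → ℤ × ℤ → ENNReal := fun n j => ⨅ (y : E2) (_ : cel n y = j), w y with hm
  set T : ℕ → ℤ × ℤ → Set ℝ := fun n j => toMeasurable volume (p '' (G ∩ cel n ⁻¹' {j})) with hT
  set g : ℕ → ℝ → ENNReal := fun n t => ∑' j, (T n j).indicator (fun _ => m n j) t with hg
  have hTm : ∀ n j, MeasurableSet (T n j) := fun n j => measurableSet_toMeasurable _ _
  have hgm : ∀ n, Measurable (g n) := fun n =>
    Measurable.tsum fun j => measurable_const.indicator (hTm n j)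
  have hgi : ∀ n, ∫⁻ t, g n t ≤ ∫⁻ x in G, w x ∂μH[1] := by
    intro n
    rw [lintegral_tsum fun j => (measurable_const.indicator (hTm n j)).aemeasurable]
    have hcm : ∀ j, MeasurableSet (G ∩ cel n ⁻¹' {j}) := fun j =>
      hG.inter (cel_meas n (measurableSet_singleton j))
    have hU : G = ⋃ j, (G ∩ cel n ⁻¹' {j}) := by
      ext x; simp
    conv_rhs => rw [hU]
    rw [lintegral_iUnion hcm]
    · refine ENNReal.tsum_le_tsum fun j => ?_
      rw [lintegral_indicator_const (hTm n j), measure_toMeasurable]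
      have h1 : volume (p '' (G ∩ cel n ⁻¹' {j})) ≤ μH[1] (G ∩ cel n ⁻¹' {j}) := by
        rw [← hausdorffMeasure_real]
        simpa using hp.hausdorffMeasure_image_le (d := 1) zero_le_one (G ∩ cel n ⁻¹' {j})
      calc m n j * volume (p '' (G ∩ cel n ⁻¹' {j})) ≤ m n j * μH[1] (G ∩ cel n ⁻¹' {j}) := by gcongr
        _ = ∫⁻ x in (G ∩ cel n ⁻¹' {j}), m n j ∂μH[1] := by rw [setLIntegral_const]
        _ ≤ _ := by
          refine setLIntegral_mono' (hcm j) fun x hx => ?_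
          exact iInf₂_le x hx.2
    · intro i j hij
      refine Set.disjoint_left.2 fun x hx hx' => hij ?_
      rw [← hx.2, ← hx'.2]
  have hpt : ∀ t, (⨆ (F : Finset E2) (_ : ∀ x ∈ F, x ∈ G ∧ p x = t), ∑ x ∈ F, w x) ≤ Filter.liminf (fun n => g n t) Filter.atTop := by
    intro t
    refine iSup₂_le fun F hF => ?_
    have ht : Filter.Tendsto (fun n => ∑ x ∈ F, m n (cel n x)) Filter.atTop (nhds (∑ x ∈ F, w x)) := by
      refine tendsto_finsetSum _ fun x hx => tendsto_order.2 ⟨fun b hb => ?_, fun b hb => ?_⟩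
      · obtain ⟨b', hb1, hb2⟩ := exists_between hb
        obtain ⟨ε, hε, h⟩ := Metric.eventually_nhds_iff.1 (hw.continuousAt.eventually (lt_mem_nhds hb2))
        filter_upwards [cel_small x ε hε] with n hn
        exact hb1.trans_le (le_iInf₂ fun y hy => (h (hn y hy)).le)
      · exact Filter.Eventually.of_forall fun n => lt_of_le_of_lt (iInf₂_le (f := fun (y : E2) (_ : cel n y = cel n x) => w y) x rfl) hb
    rw [← ht.liminf_eq]
    refine Filter.liminf_le_liminf ?_
    have hinj : ∀ᶠ n in Filter.atTop, Set.InjOn (cel n) F := by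
      have : ∀ᶠ n in Filter.atTop, ∀ x ∈ F, ∀ y ∈ F, cel n x = cel n y → x = y := by
        rw [Filter.eventually_all_finset]
        intro x hx
        rw [Filter.eventually_all_finset]
        intro y hy
        by_cases hxy : x = y
        · simp [hxy]
        · filter_upwards [cel_small y (dist x y) (dist_pos.2 hxy)] with n hn h
          exact absurd (hn x h) (lt_irrefl _)
      filter_upwards [this] with n hn x hx y hy h
      exact hn x hx y hy h
    filter_upwards [hinj] with n hn
    calc ∑ x ∈ F, m n (cel n x) = ∑ j ∈ F.image (cel n), m n j := (Finset.sum_image hn).symm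
      _ = ∑ j ∈ F.image (cel n), (T n j).indicator (fun _ => m n j) t := by
        refine Finset.sum_congr rfl fun j hj => ?_
        rw [Set.indicator_of_mem]
        obtain ⟨x, hx, rfl⟩ := Finset.mem_image.1 hj
        exact subset_toMeasurable _ _ ⟨x, ⟨(hF x hx).1, rfl⟩, (hF x hx).2⟩
      _ ≤ g n t := ENNReal.sum_le_tsum _
  refine ⟨_, Measurable.liminf hgm, hpt, ?_⟩
  calc _ ≤ Filter.liminf (fun n => ∫⁻ t, g n t) Filter.atTop := lintegral_liminf_le hgm
    _ ≤ Filter.liminf (fun n : ℕ => ∫⁻ x in G, w x ∂μH[1]) Filter.atTop :=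
      Filter.liminf_le_liminf (Filter.Eventually.of_forall hgi)
    _ = _ := by simp

lemma conn_dich (V I : Set ℝ) (hI : IsPreconnected I) (h : Disjoint (frontier V) I) : I ⊆ V ∨ Disjoint I V := by
  have hc : I ⊆ interior V ∪ (closure V)ᶜ := fun x hx => by
    by_contra hc
    rw [Set.mem_union, not_or, Set.mem_compl_iff, not_not] at hc
    exact Set.disjoint_left.1 h ⟨hc.2, hc.1⟩ hx
  rcases hI.subset_or_subset isOpen_interior (isClosed_closure (s := V)).isOpen_compl
    (Set.disjoint_left.2 fun x hx hx' => hx' (subset_closure (interior_subset hx))) hc with h1 | h1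
  · exact Or.inl (h1.trans interior_subset)
  · exact Or.inr (Set.disjoint_left.2 fun x hx hx' => h1 hx (subset_closure hx'))

lemma oneD_aux (h : ℝ → ℝ) (hh : ContDiff ℝ 1 h) (V : Set ℝ) (hV : MeasurableSet V) (hb : BddAbove V) (F : Finset ℝ) :
    ∀ a, (∀ s ∈ F, a < s) → (∀ s ∈ frontier V, a < s → s ∈ F) →
    ∃ ε : ℝ, (ε = 0 ∨ (ε = 1 ∧ ∃ c, a < c ∧ Set.Ioo a c ⊆ V)) ∧ |(∫ s in V ∩ Set.Ioi a, deriv h s) + ε * h a| ≤ ∑ s ∈ F, |h s| := by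
  obtain ⟨M, hM⟩ := hb
  have hcd : Continuous (deriv h) := hh.continuous_deriv le_rfl
  induction F using Finset.induction_on_min with
  | empty =>
    intro a _ h2
    refine ⟨0, Or.inl rfl, ?_⟩
    rcases conn_dich V (Set.Ioi a) isPreconnected_Ioi (Set.disjoint_left.2 fun s hs hs' => by simpa using h2 s hs hs') with h3 | h3
    · exfalso
      have := hM (h3 (show max a M + 1 ∈ Set.Ioi a from by simp; linarith [le_max_left a M]))
      linarith [le_max_right a M]
    · rw [Set.inter_comm, Set.disjoint_iff_inter_eq_empty.1 h3]; simp
  | insert m F hm ih =>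
    intro a h1 h2
    have ham : a < m := h1 m (by simp)
    have hmF : m ∉ F := fun hc => lt_irrefl _ (hm m hc)
    obtain ⟨ε', hε', hI⟩ := ih m hm (fun s hs hs' => by
      have := h2 s hs (ham.trans hs')
      rcases Finset.mem_insert.1 this with rfl | h
      · exact absurd hs' (lt_irrefl _)
      · exact h)
    have hε1 : |1 - ε'| ≤ 1 ∧ |ε'| ≤ 1 := by
      rcases hε' with h | ⟨h, _⟩ <;> rw [h] <;> norm_num
    rw [Finset.sum_insert hmF]
    have hint : IntegrableOn (deriv h) (Set.Icc a (max m M)) := hcd.integrableOn_Icc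
    have hsplit : ∫ s in V ∩ Set.Ioi a, deriv h s = (∫ s in V ∩ Set.Ioo a m, deriv h s) + ∫ s in V ∩ Set.Ioi m, deriv h s := by
      rw [← setIntegral_union]
      · apply setIntegral_congr_set
        rw [← Set.inter_union_distrib_left]
        have : (Set.Ioo a m ∪ Set.Ioi m : Set ℝ) =ᵐ[volume] Set.Ioi a := by
          rw [← Set.Ioc_union_Ioi_eq_Ioi ham.le]
          exact Ioo_ae_eq_Ioc.union (ae_eq_refl _)
        exact ((ae_eq_refl V).inter this).symm
      · exact Set.disjoint_left.2 fun s hs hs' => lt_asymm hs.2.2 hs'.2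
      · exact hV.inter measurableSet_Ioi
      · exact hint.mono_set fun s hs => ⟨hs.2.1.le, hs.2.2.le.trans (le_max_left _ _)⟩
      · exact hint.mono_set fun s hs => ⟨(ham.trans hs.2).le, (hM hs.1).trans (le_max_right _ _)⟩
    rcases conn_dich V (Set.Ioo a m) isPreconnected_Ioo (Set.disjoint_left.2 fun s hs hs' => by
        rcases Finset.mem_insert.1 (h2 s hs hs'.1) with rfl | h
        · exact lt_irrefl _ hs'.2
        · exact lt_asymm hs'.2 (hm s h)) with h3 | h3
    · refine ⟨1, Or.inr ⟨rfl, m, ham, h3⟩, ?_⟩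
      rw [hsplit, Set.inter_eq_self_of_subset_right h3, ← integral_Ioc_eq_integral_Ioo, ← intervalIntegral.integral_of_le ham.le,
        intervalIntegral.integral_deriv_eq_sub (fun x _ => (hh.differentiable one_ne_zero).differentiableAt) (hcd.intervalIntegrable _ _)]
      calc _ = |((∫ s in V ∩ Set.Ioi m, deriv h s) + ε' * h m) + (1 - ε') * h m| := by congr 1; ring
        _ ≤ _ := abs_add_le _ _
        _ ≤ _ := by rw [abs_mul]; nlinarith [abs_nonneg (h m), hε1.1]
    · refine ⟨0, Or.inl rfl, ?_⟩
      rw [hsplit, Set.inter_comm V (Set.Ioo a m), Set.disjoint_iff_inter_eq_empty.1 h3]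
      simp only [Measure.restrict_empty, integral_zero_measure, zero_add, zero_mul, add_zero]
      calc _ = |((∫ s in V ∩ Set.Ioi m, deriv h s) + ε' * h m) - ε' * h m| := by congr 1; ring
        _ ≤ _ := abs_sub _ _
        _ ≤ _ := by rw [abs_mul]; nlinarith [abs_nonneg (h m), hε1.2]

lemma oneD (h : ℝ → ℝ) (hh : ContDiff ℝ 1 h) (V : Set ℝ) (hV : MeasurableSet V) (hb : Bornology.IsBounded V) (F : Finset ℝ)
    (hF : frontier V ⊆ F) : |∫ s in V, deriv h s| ≤ ∑ s ∈ F, |h s| := by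
  classical
  obtain ⟨M, hM⟩ := hb.bddBelow
  set F' := F.filter (fun s => M - 1 < s)
  obtain ⟨ε, hε, hI⟩ := oneD_aux h hh V hV hb.bddAbove F' (M-1) (fun s hs => (Finset.mem_filter.1 hs).2)
    (fun s hs hs' => Finset.mem_filter.2 ⟨hF hs, hs'⟩)
  have hVI : V ∩ Set.Ioi (M-1) = V := Set.inter_eq_left.2 fun s hs => by
    have := hM hs
    simp; linarith
  have hε0 : ε = 0 := by
    rcases hε with h | ⟨h, c, hc, hcV⟩
    · exact h
    · exfalso
      obtain ⟨x, hx1, hx2⟩ := exists_between (show M - 1 < min c M by simp [hc])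
      have := hM (hcV ⟨hx1, hx2.trans_le (min_le_left _ _)⟩)
      linarith [min_le_right c M]
  rw [hVI, hε0, zero_mul, add_zero] at hI
  exact hI.trans (Finset.sum_le_sum_of_subset_of_nonneg (Finset.filter_subset _ _) fun _ _ _ => abs_nonneg _)

noncomputable def fr (b : OrthonormalBasis (Fin 2) ℝ E2) : ℝ × ℝ ≃ᵐ E2 :=
  (MeasurableEquiv.finTwoArrow (α := ℝ)).symm.trans ((MeasurableEquiv.toLp 2 (Fin 2 → ℝ)).trans b.measurableEquiv.symm)

lemma fr_mp (b : OrthonormalBasis (Fin 2) ℝ E2) : MeasurePreserving (fr b) volume volume :=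
  (b.measurePreserving_measurableEquiv.symm.comp (PiLp.volume_preserving_toLp (Fin 2))).comp
    ((volume_preserving_finTwoArrow ℝ).symm _)

lemma fr_apply (b : OrthonormalBasis (Fin 2) ℝ E2) (s t : ℝ) : fr b (s, t) = s • b 0 + t • b 1 := by
  have : fr b (s, t) = b.repr.symm (WithLp.toLp 2 ![s, t]) := rfl
  rw [this, ← b.sum_repr_symm]
  simp

lemma fr_inner0 (b : OrthonormalBasis (Fin 2) ℝ E2) (s t : ℝ) : inner ℝ (b 0) (fr b (s, t)) = s := by
  rw [fr_apply, inner_add_right, inner_smul_right, inner_smul_right]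
  simp [b.inner_eq_ite]

lemma fr_inner1 (b : OrthonormalBasis (Fin 2) ℝ E2) (s t : ℝ) : inner ℝ (b 1) (fr b (s, t)) = t := by
  rw [fr_apply, inner_add_right, inner_smul_right, inner_smul_right]
  simp [b.inner_eq_ite]

lemma gg0 (b : OrthonormalBasis (Fin 2) ℝ E2) (U : Set E2) (hU : IsOpen U) (hUb : Bornology.IsBounded U)
    (hfin : μH[1] (frontier U) ≠ ⊤) (g : E2 → ℝ) (hg : ContDiff ℝ 1 g) :
    ‖∫ x in U, fderiv ℝ g x (b 0)‖ₑ ≤ ∫⁻ x in frontier U, ‖g x‖ₑ ∂μH[1] := by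
  classical
  set p : E2 → ℝ := fun x => inner ℝ (b 1) x with hpdef
  have hp : LipschitzWith 1 p := by
    refine LipschitzWith.of_dist_le_mul fun x y => ?_
    rw [Real.dist_eq, hpdef]
    simp only
    rw [← inner_sub_right, dist_eq_norm]
    refine (abs_real_inner_le_norm _ _).trans ?_
    simp
  have hGm : MeasurableSet (frontier U) := isClosed_frontier.measurableSet
  have hD : Continuous fun x => fderiv ℝ g x (b 0) :=
    (hg.continuous_fderiv one_ne_zero).clm_apply continuous_const
  have hint : IntegrableOn (fun x => fderiv ℝ g x (b 0)) U :=
    (hD.continuousOn.integrableOn_compact hUb.isCompact_closure).mono_set subset_closure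
  have hint' : Integrable (fun q : ℝ × ℝ => U.indicator (fun x => fderiv ℝ g x (b 0)) (fr b q)) (volume.prod volume) := by
    have := (fr_mp b).integrable_comp_emb (fr b).measurableEmbedding (g := U.indicator (fun x => fderiv ℝ g x (b 0)))
    exact this.2 (hint.integrable_indicator hU.measurableSet)
  have hF : ∫ x in U, fderiv ℝ g x (b 0) = ∫ t, ∫ s, U.indicator (fun x => fderiv ℝ g x (b 0)) (fr b (s, t)) := by
    rw [← integral_indicator hU.measurableSet, ← (fr_mp b).integral_comp (fr b).measurableEmbedding]
    exact integral_prod_symm _ hint'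
  set H : (E2 → ENNReal) → ℝ → ENNReal := fun w t => ⨆ (F : Finset E2) (_ : ∀ x ∈ F, x ∈ frontier U ∧ p x = t), ∑ x ∈ F, w x with hH
  have hae : ∀ᵐ t : ℝ, {x | x ∈ frontier U ∧ p x = t}.Finite := by
    obtain ⟨k, hkm, hk, hki⟩ := eil p hp _ hGm 1 continuous_one
    have h2 : ∫⁻ t, k t ≠ ⊤ := by
      refine ne_top_of_le_ne_top hfin (hki.trans ?_)
      simp
    filter_upwards [ae_lt_top hkm h2] with t ht
    by_contra hinf
    obtain ⟨N, hN⟩ := ENNReal.exists_nat_gt ht.ne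
    obtain ⟨F, hFs, hFc⟩ := Set.Infinite.exists_subset_card_eq hinf N
    have h3 : ∑ x ∈ F, (1 : E2 → ENNReal) x ≤ k t := by
      refine le_trans ?_ (hk t)
      exact le_iSup₂_of_le F (fun x hx => hFs hx) le_rfl
    simp [hFc] at h3
    exact absurd h3 (not_le.2 hN)
  obtain ⟨k, hkm, hk, hki⟩ := eil p hp _ hGm (fun x => ‖g x‖ₑ) (by fun_prop)
  have hslice : ∀ᵐ t : ℝ, ‖∫ s, U.indicator (fun x => fderiv ℝ g x (b 0)) (fr b (s, t))‖ₑ ≤ H (fun x => ‖g x‖ₑ) t := by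
    filter_upwards [hae] with t ht
    set ℓ : ℝ → E2 := fun s => fr b (s, t) with hℓ
    have hℓ' : ℓ = fun s => s • b 0 + t • b 1 := by funext s; exact fr_apply b s t
    have hℓd : ∀ s, HasDerivAt ℓ (b 0) s := by
      intro s; rw [hℓ']
      simpa using ((hasDerivAt_id s).smul_const (b 0)).add_const (t • b 1)
    have hℓc : ContDiff ℝ 1 ℓ := by rw [hℓ']; fun_prop
    have hcont : Continuous ℓ := hℓc.continuous
    set V := ℓ ⁻¹' U with hV
    have hVo : IsOpen V := hU.preimage hcont
    have hd : ∀ s, deriv (g ∘ ℓ) s = fderiv ℝ g (ℓ s) (b 0) := fun s =>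
      ((hg.differentiable one_ne_zero _).hasFDerivAt.comp_hasDerivAt s (hℓd s)).deriv
    have heq : ∫ s, U.indicator (fun x => fderiv ℝ g x (b 0)) (fr b (s, t)) = ∫ s in V, deriv (g ∘ ℓ) s := by
      rw [← integral_indicator hVo.measurableSet]
      congr 1
      funext s
      simp only [Set.indicator, hd]
      rfl
    have hVb : Bornology.IsBounded V := by
      obtain ⟨M, hM⟩ := hUb.exists_norm_le
      refine (isBounded_iff_forall_norm_le).2 ⟨M, fun s hs => ?_⟩
      have := abs_real_inner_le_norm (b 0) (ℓ s)
      rw [fr_inner0] at this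
      refine this.trans ?_
      simpa using hM _ hs
    have hfr : frontier V ⊆ ℓ ⁻¹' (frontier U) := hcont.frontier_preimage_subset U
    have hinj : Function.Injective ℓ := fun s s' h => by
      have := congrArg (inner ℝ (b 0)) h
      simpa [hℓ, fr_inner0] using this
    have hfinV : (frontier V).Finite := by
      refine Set.Finite.of_finite_image (ht.subset ?_) hinj.injOn
      rintro _ ⟨s, hs, rfl⟩
      exact ⟨hfr hs, fr_inner1 b s t⟩
    have h1 := oneD (g ∘ ℓ) (hg.comp hℓc) V hVo.measurableSet hVb hfinV.toFinset (by simp)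
    rw [heq]
    have h2 : ∑ x ∈ hfinV.toFinset.image ℓ, ‖g x‖ₑ ≤ H (fun x => ‖g x‖ₑ) t := by
      refine le_iSup₂_of_le (hfinV.toFinset.image ℓ) ?_ le_rfl
      intro x hx
      obtain ⟨s, hs, rfl⟩ := Finset.mem_image.1 hx
      exact ⟨hfr (by simpa using hs), fr_inner1 b s t⟩
    refine le_trans ?_ h2
    rw [Finset.sum_image hinj.injOn]
    rw [← Real.norm_eq_abs] at h1
    calc _ ≤ ENNReal.ofReal (∑ s ∈ hfinV.toFinset, |(g ∘ ℓ) s|) := by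
          rw [← ofReal_norm]; exact ENNReal.ofReal_le_ofReal h1
      _ = _ := by
        rw [ENNReal.ofReal_sum_of_nonneg fun _ _ => abs_nonneg _]
        refine Finset.sum_congr rfl fun s _ => ?_
        rw [← ofReal_norm]; rfl
  rw [hF]
  calc _ ≤ ∫⁻ t, ‖∫ s, U.indicator (fun x => fderiv ℝ g x (b 0)) (fr b (s, t))‖ₑ := enorm_integral_le_lintegral_enorm _
    _ ≤ ∫⁻ t, k t := lintegral_mono_ae (hslice.mono fun t ht => ht.trans (hk t))
    _ ≤ _ := hki


lemma exists_onb (e : E2) (he : ‖e‖ = 1) : ∃ b : OrthonormalBasis (Fin 2) ℝ E2, b 0 = e := by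
  have h := Orthonormal.exists_orthonormalBasis_extension_of_card_eq (𝕜 := ℝ) (E := E2) (ι := Fin 2) (by simp)
    (v := fun _ => e) (s := {0}) ?_
  · obtain ⟨b, hb⟩ := h
    exact ⟨b, hb 0 (by simp)⟩
  · constructor
    · intro i; simpa using he
    · intro i j hij; exact absurd (Subsingleton.elim i j) hij

lemma gg_int (U : Set E2) (hUb : Bornology.IsBounded U)
    (hfin : μH[1] (frontier U) ≠ ⊤) (g : E2 → ℝ) (hg : Continuous g) : IntegrableOn g (frontier U) μH[1] := by
  have hc : IsCompact (frontier U) := hUb.isCompact_closure.of_isClosed_subset isClosed_frontier frontier_subset_closure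
  obtain ⟨C, hC⟩ := hc.exists_bound_of_continuousOn hg.continuousOn
  refine Measure.integrableOn_of_bounded (M := C) hfin ?_ ?_
  · exact hg.aestronglyMeasurable
  · exact (ae_restrict_iff' isClosed_frontier.measurableSet).2 (Filter.Eventually.of_forall hC)

lemma D_int (U : Set E2) (hUb : Bornology.IsBounded U) (g : E2 → ℝ) (hg : ContDiff ℝ 1 g) (v : E2) :
    IntegrableOn (fun x => fderiv ℝ g x v) U := by
  have hD : Continuous fun x => fderiv ℝ g x v :=
    (hg.continuous_fderiv one_ne_zero).clm_apply continuous_const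
  exact (hD.continuousOn.integrableOn_compact hUb.isCompact_closure).mono_set subset_closure

lemma gg (U : Set E2) (hU : IsOpen U) (hUb : Bornology.IsBounded U)
    (hfin : μH[1] (frontier U) ≠ ⊤) (g : E2 → ℝ) (hg : ContDiff ℝ 1 g) (v : E2) :
    |∫ x in U, fderiv ℝ g x v| ≤ ‖v‖ * ∫ x in frontier U, |g x| ∂μH[1] := by
  by_cases hv : v = 0
  · simp [hv]
  have hv' : 0 < ‖v‖ := norm_pos_iff.2 hv
  obtain ⟨b, hb⟩ := exists_onb (‖v‖⁻¹ • v) (by rw [norm_smul, norm_inv, norm_norm, inv_mul_cancel₀ hv'.ne'])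
  have hvb : v = ‖v‖ • b 0 := by rw [hb, smul_smul, mul_inv_cancel₀ hv'.ne', one_smul]
  have h0 := gg0 b U hU hUb hfin g hg
  have h1 : ∫⁻ x in frontier U, ‖g x‖ₑ ∂μH[1] = ENNReal.ofReal (∫ x in frontier U, |g x| ∂μH[1]) :=
    (ofReal_integral_norm_eq_lintegral_enorm (gg_int U hUb hfin g hg.continuous)).symm
  have h3 : 0 ≤ ∫ x in frontier U, |g x| ∂μH[1] := integral_nonneg fun x => abs_nonneg _
  rw [h1, ← ofReal_norm, ENNReal.ofReal_le_ofReal_iff h3, Real.norm_eq_abs] at h0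
  have h2 : ∫ x in U, fderiv ℝ g x v = ‖v‖ * ∫ x in U, fderiv ℝ g x (b 0) := by
    rw [← integral_const_mul]
    congr 1; funext x
    conv_lhs => rw [hvb, map_smul]
    rfl
  rw [h2, abs_mul, abs_norm]
  gcongr

lemma gg_piece (U : Set E2) (hU : IsOpen U) (hUb : Bornology.IsBounded U)
    (hfin : μH[1] (frontier U) ≠ ⊤) (ψ f0 f1 : E2 → ℝ) (hψ : ContDiff ℝ 1 ψ) (hf0 : ContDiff ℝ 1 f0) (hf1 : ContDiff ℝ 1 f1)
    (e0 e1 : E2) (h0 : ‖e0‖ = 1) (h1 : ‖e1‖ = 1) (c0 c1 M ε : ℝ) (hM : ‖c0 • e0 + c1 • e1‖ ≤ M) (hψ0 : ∀ x, 0 ≤ ψ x)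
    (hs0 : ∀ x, ψ x ≠ 0 → |f0 x - c0| ≤ ε) (hs1 : ∀ x, ψ x ≠ 0 → |f1 x - c1| ≤ ε) :
    |(∫ x in U, fderiv ℝ (fun x => ψ x * f0 x) x e0) + ∫ x in U, fderiv ℝ (fun x => ψ x * f1 x) x e1| ≤
      (M + 2 * ε) * ∫ x in frontier U, ψ x ∂μH[1] := by
  have key : ∀ (f : E2 → ℝ) (hf : ContDiff ℝ 1 f) (c : ℝ) (e : E2) (he : ‖e‖ = 1) (hs : ∀ x, ψ x ≠ 0 → |f x - c| ≤ ε),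
      ∃ r : ℝ, |r| ≤ ε * (∫ x in frontier U, ψ x ∂μH[1]) ∧ ∫ x in U, fderiv ℝ (fun x => ψ x * f x) x e
        = r + ∫ x in U, fderiv ℝ ψ x (c • e) := by
    intro f hf c e he hs
    have hc : ContDiff ℝ 1 (fun x => ψ x * (f x - c)) := hψ.mul (hf.sub contDiff_const)
    refine ⟨∫ x in U, fderiv ℝ (fun x => ψ x * (f x - c)) x e, ?_, ?_⟩
    · refine (gg U hU hUb hfin _ hc e).trans ?_
      rw [he, one_mul, ← integral_const_mul]
      refine integral_mono (gg_int U hUb hfin _ (by fun_prop)) ((gg_int U hUb hfin _ hψ.continuous).const_mul ε) fun x => ?_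
      simp only [abs_mul, abs_of_nonneg (hψ0 x)]
      by_cases hx : ψ x = 0
      · simp [hx]
      · rw [mul_comm]; exact mul_le_mul_of_nonneg_right (hs x hx) (hψ0 x)
    · rw [← integral_add (D_int U hUb _ hc e) (D_int U hUb _ hψ _)]
      congr 1; funext x
      have e1 : (fun x => ψ x * f x) = fun x => ψ x * (f x - c) + c * ψ x := by funext x; ring
      have d1 : DifferentiableAt ℝ ψ x := hψ.differentiable one_ne_zero x
      rw [e1, fderiv_fun_add (hc.differentiable one_ne_zero x) (d1.const_mul c), fderiv_const_mul d1]
      simp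
  obtain ⟨r0, hr0, hr0'⟩ := key f0 hf0 c0 e0 h0 hs0
  obtain ⟨r1, hr1, hr1'⟩ := key f1 hf1 c1 e1 h1 hs1
  have hc := gg U hU hUb hfin ψ hψ (c0 • e0 + c1 • e1)
  have hψa : (fun x => |ψ x|) = ψ := by funext x; exact abs_of_nonneg (hψ0 x)
  rw [hψa] at hc
  have hsum : ∫ x in U, fderiv ℝ ψ x (c0 • e0 + c1 • e1) = (∫ x in U, fderiv ℝ ψ x (c0 • e0)) + ∫ x in U, fderiv ℝ ψ x (c1 • e1) := by
    rw [← integral_add (D_int U hUb _ hψ _) (D_int U hUb _ hψ _)]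
    simp only [map_add]
  have hI : 0 ≤ ∫ x in frontier U, ψ x ∂μH[1] := integral_nonneg hψ0
  rw [hr0', hr1']
  rw [hsum] at hc
  have hc' := hc.trans (mul_le_mul_of_nonneg_right hM hI)
  rw [abs_le] at *
  constructor <;> linarith [hc'.1, hc'.2, hr0.1, hr0.2, hr1.1, hr1.2]

open scoped Manifold ContDiff in
lemma gg_vec (U : Set E2) (hU : IsOpen U) (hUb : Bornology.IsBounded U)
    (hfin : μH[1] (frontier U) ≠ ⊤) (f0 f1 : E2 → ℝ) (hf0 : ContDiff ℝ 1 f0) (hf1 : ContDiff ℝ 1 f1)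
    (e0 e1 : E2) (h0 : ‖e0‖ = 1) (h1 : ‖e1‖ = 1) (M : ℝ) (hM : ∀ x, ‖f0 x • e0 + f1 x • e1‖ ≤ M) :
    |∫ x in U, (fderiv ℝ f0 x e0 + fderiv ℝ f1 x e1)| ≤ M * (μH[1] (frontier U)).toReal := by
  classical
  set m := (μH[1] (frontier U)).toReal with hm
  suffices h : ∀ ε > 0, |∫ x in U, (fderiv ℝ f0 x e0 + fderiv ℝ f1 x e1)| ≤ (M + 2 * ε) * m by
    refine le_of_forall_pos_le_add fun δ hδ => ?_
    have hm0 : 0 ≤ m := ENNReal.toReal_nonneg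
    refine (h (δ / (2 * (m + 1))) (by positivity)).trans ?_
    have : 2 * (δ / (2 * (m + 1))) * m ≤ δ := by
      rw [show 2 * (δ / (2 * (m + 1))) * m = δ * (m / (m+1)) by field_simp]
      have : m / (m+1) ≤ 1 := by rw [div_le_one (by positivity)]; linarith
      nlinarith
    linarith
  intro ε hε
  set W : E2 → Set E2 := fun x => {y | |f0 y - f0 x| < ε} ∩ {y | |f1 y - f1 x| < ε} with hW
  have c0 := hf0.continuous
  have c1 := hf1.continuous
  have hWo : ∀ x, IsOpen (W x) := fun x =>
    (isOpen_lt (by fun_prop) continuous_const).inter (isOpen_lt (by fun_prop) continuous_const)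
  have hK : IsCompact (closure U) := hUb.isCompact_closure
  obtain ⟨T, -, hT⟩ := hK.elim_nhds_subcover W (fun x _ => (hWo x).mem_nhds (by simp [hW, hε]))
  obtain ⟨ρ, hρ⟩ := SmoothPartitionOfUnity.exists_isSubordinate 𝓘(ℝ, E2) (isClosed_closure (s := U))
    (fun i : T => W i) (fun i => hWo i) (by simpa [Set.iUnion_subtype] using hT)
  have hρc : ∀ i, ContDiff ℝ 1 (ρ i) := fun i => ((ρ i).contMDiff.contDiff).of_le (by exact_mod_cast le_top)
  have hρ1 : ∀ x ∈ closure U, ∑ i, ρ i x = 1 := fun x hx => by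
    rw [← finsum_eq_sum_of_fintype]; exact ρ.sum_eq_one hx
  have hρs : ∀ i x, ρ i x ≠ 0 → x ∈ W i := fun i x hx => hρ i (subset_tsupport _ hx)
  have hsplit : ∀ (f : E2 → ℝ) (hf : ContDiff ℝ 1 f) (e : E2), ∫ x in U, fderiv ℝ f x e = ∑ i, ∫ x in U, fderiv ℝ (fun x => ρ i x * f x) x e := by
    intro f hf e
    rw [← integral_finsetSum _ (fun i _ => D_int U hUb _ ((hρc i).mul hf) e)]
    refine setIntegral_congr_fun hU.measurableSet fun x hx => ?_
    have e2 : f =ᶠ[nhds x] fun x => ∑ i, ρ i x * f x := by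
      filter_upwards [hU.mem_nhds hx] with y hy
      rw [← Finset.sum_mul, hρ1 y (subset_closure hy), one_mul]
    rw [e2.fderiv_eq, fderiv_fun_sum (fun i _ => ((hρc i).mul hf).differentiable one_ne_zero x)]
    simp
  rw [integral_add (D_int U hUb _ hf0 _) (D_int U hUb _ hf1 _), hsplit f0 hf0, hsplit f1 hf1, ← Finset.sum_add_distrib]
  refine (Finset.abs_sum_le_sum_abs _ _).trans ?_
  calc _ ≤ ∑ i, (M + 2 * ε) * ∫ x in frontier U, ρ i x ∂μH[1] := by
        refine Finset.sum_le_sum fun i _ => ?_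
        exact gg_piece U hU hUb hfin (ρ i) f0 f1 (hρc i) hf0 hf1 e0 e1 h0 h1 (f0 i) (f1 i) M ε (hM i) (fun x => ρ.nonneg i x)
          (fun x hx => (hρs i x hx).1.le) (fun x hx => (hρs i x hx).2.le)
    _ = (M + 2 * ε) * m := by
      rw [← Finset.mul_sum, ← integral_finsetSum _ (fun i _ => gg_int U hUb hfin _ (hρc i).continuous)]
      congr 1
      rw [setIntegral_congr_fun (g := fun _ => (1:ℝ)) isClosed_frontier.measurableSet
        (fun x hx => hρ1 x (frontier_subset_closure hx))]
      simp [hm, Measure.real]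


lemma param_hasFDeriv (K : Set E2) (hK : IsCompact K) (k : E2 → ℝ) (hk : ContDiff ℝ 1 k) (x : E2) :
    HasFDerivAt (fun x => ∫ y in K, k (x - y)) (∫ y in K, fderiv ℝ k (x - y)) x := by
  have hkc : Continuous k := hk.continuous
  have hk' : Continuous (fderiv ℝ k) := hk.continuous_fderiv one_ne_zero
  have hfin : IsFiniteMeasure (volume.restrict K) := ⟨by simpa using hK.measure_lt_top⟩
  have hcomp : IsCompact ((fun q : E2 × E2 => q.1 - q.2) '' (Metric.closedBall x 1 ×ˢ K)) :=
    ((isCompact_closedBall x 1).prod hK).image (by fun_prop)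
  obtain ⟨C, hC⟩ := hcomp.exists_bound_of_continuousOn hk'.continuousOn
  refine hasFDerivAt_integral_of_dominated_of_fderiv_le (𝕜 := ℝ) (F := fun x y => k (x - y))
    (F' := fun x y => fderiv ℝ k (x - y)) (s := Metric.closedBall x 1) (bound := fun _ => C)
    (Metric.closedBall_mem_nhds x one_pos) ?_ ?_ ?_ ?_ ?_ ?_
  · exact Filter.Eventually.of_forall fun z => (by fun_prop : Continuous fun y => k (z - y)).aestronglyMeasurable
  · exact (by fun_prop : Continuous fun y => k (x - y)).continuousOn.integrableOn_compact hK
  · exact (by fun_prop : Continuous fun y => fderiv ℝ k (x - y)).aestronglyMeasurable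
  · refine (ae_restrict_iff' hK.measurableSet).2 (Filter.Eventually.of_forall fun y hy z hz => ?_)
    exact hC _ ⟨(z, y), ⟨hz, hy⟩, rfl⟩
  · exact integrable_const C
  · refine Filter.Eventually.of_forall fun y z hz => ?_
    have h1 : HasFDerivAt k (fderiv ℝ k (z - y)) (z - y) := (hk.differentiable one_ne_zero _).hasFDerivAt
    exact h1.comp z ((hasFDerivAt_id z).sub_const y)

lemma param_contDiff (K : Set E2) (hK : IsCompact K) (k : E2 → ℝ) (hk : ContDiff ℝ 1 k) :
    ContDiff ℝ 1 (fun x => ∫ y in K, k (x - y)) := by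
  have hk' : Continuous (fderiv ℝ k) := hk.continuous_fderiv one_ne_zero
  rw [contDiff_one_iff_fderiv]
  refine ⟨fun x => (param_hasFDeriv K hK k hk x).differentiableAt, ?_⟩
  have : fderiv ℝ (fun x => ∫ y in K, k (x - y)) = fun x => ∫ y in K, fderiv ℝ k (x - y) := by
    funext x; exact (param_hasFDeriv K hK k hk x).fderiv
  rw [this]
  exact continuous_parametric_integral_of_continuous (by fun_prop) hK

lemma param_fderiv (K : Set E2) (hK : IsCompact K) (k : E2 → ℝ) (hk : ContDiff ℝ 1 k) (x v : E2) :
    fderiv ℝ (fun x => ∫ y in K, k (x - y)) x v = ∫ y in K, fderiv ℝ k (x - y) v := by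
  have hk' : Continuous (fderiv ℝ k) := hk.continuous_fderiv one_ne_zero
  rw [(param_hasFDeriv K hK k hk x).fderiv]
  rw [ContinuousLinearMap.integral_apply]
  exact (by fun_prop : Continuous fun y => fderiv ℝ k (x - y)).continuousOn.integrableOn_compact hK

noncomputable def ker (a : ℝ) (i : Fin 2) (z : E2) : ℝ := z i / (‖z‖ ^ 2 + a)

lemma ker_contDiff (a : ℝ) (ha : 0 < a) (i : Fin 2) : ContDiff ℝ 1 (ker a i) := by
  unfold ker
  refine ContDiff.div ?_ ((contDiff_norm_sq ℝ).add contDiff_const) (fun z => by positivity)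
  fun_prop

lemma normsq (z : E2) : ‖z‖ ^ 2 = z 0 ^ 2 + z 1 ^ 2 := by
  rw [EuclideanSpace.real_norm_sq_eq, Fin.sum_univ_two]

lemma ker_fderiv (a : ℝ) (ha : 0 < a) (i : Fin 2) (z : E2) :
    fderiv ℝ (ker a i) z (EuclideanSpace.single i 1) = (‖z‖ ^ 2 + a - 2 * z i ^ 2) / (‖z‖ ^ 2 + a) ^ 2 := by
  have h1 : HasFDerivAt (ker a i) (fderiv ℝ (ker a i) z) z := ((ker_contDiff a ha i).differentiable one_ne_zero z).hasFDerivAt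
  have hl : HasDerivAt (fun t : ℝ => z + t • (EuclideanSpace.single i 1 : E2)) (EuclideanSpace.single i 1) 0 := by
    simpa using ((hasDerivAt_id (0:ℝ)).smul_const (EuclideanSpace.single i 1 : E2)).const_add z
  have h2 := HasFDerivAt.comp_hasDerivAt (x := (0:ℝ)) (l := ker a i) (l' := fderiv ℝ (ker a i) z) 
    (f := fun t : ℝ => z + t • (EuclideanSpace.single i 1 : E2)) (by simpa using h1) hl
  have h3 : (ker a i ∘ fun t : ℝ => z + t • (EuclideanSpace.single i 1 : E2)) = fun t => (z i + t) / (‖z‖ ^ 2 + 2 * z i * t + t ^ 2 + a) := by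
    funext t
    simp only [Function.comp, ker]
    have : ‖z + t • (EuclideanSpace.single i 1 : E2)‖ ^ 2 = ‖z‖ ^ 2 + 2 * z i * t + t ^ 2 := by
      rw [normsq, normsq]
      fin_cases i <;> simp <;> ring
    rw [this]
    simp
  rw [h3] at h2
  have hn : HasDerivAt (fun t : ℝ => z i + t) 1 0 := by simpa using (hasDerivAt_id (0:ℝ)).const_add (z i)
  have hd : HasDerivAt (fun t : ℝ => ‖z‖ ^ 2 + 2 * z i * t + t ^ 2 + a) (2 * z i) 0 := by
    have := ((((hasDerivAt_id (0:ℝ)).const_mul (2 * z i)).const_add (‖z‖^2)).add ((hasDerivAt_id (0:ℝ)).pow 2)).add_const a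
    simpa using this
  have h4 := hn.div hd (by simp; positivity)
  rw [h2.unique h4]
  simp
  ring

lemma ker_div (a : ℝ) (ha : 0 < a) (z : E2) :
    fderiv ℝ (ker a 0) z (EuclideanSpace.single 0 1) + fderiv ℝ (ker a 1) z (EuclideanSpace.single 1 1) = 2 * a / (‖z‖ ^ 2 + a) ^ 2 := by
  rw [ker_fderiv a ha, ker_fderiv a ha, normsq]
  ring

lemma ball_int (a r : ℝ) (ha : 0 < a) (hr : 0 < r) :
    ∫ z : E2, (Set.Iio r).indicator (fun t : ℝ => 2 * a / (t ^ 2 + a) ^ 2) ‖z‖ = 2 * Real.pi * (r ^ 2 / (r ^ 2 + a)) := by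
  rw [integral_fun_norm_addHaar]
  have h1 : (volume : Measure E2).real (Metric.ball 0 1) = Real.pi := by
    rw [Measure.real, EuclideanSpace.volume_ball_fin_two]
    simp [Real.pi_pos.le]
  rw [h1]
  have h2 : ∫ y in Set.Ioi (0:ℝ), y ^ (Module.finrank ℝ E2 - 1) • (Set.Iio r).indicator (fun t : ℝ => 2 * a / (t ^ 2 + a) ^ 2) y
      = ∫ y in (0:ℝ)..r, 2 * a * y / (y ^ 2 + a) ^ 2 := by
    rw [intervalIntegral.integral_of_le hr.le, integral_Ioc_eq_integral_Ioo, ← Set.Ioi_inter_Iio, Set.inter_comm, ← Measure.restrict_restrict measurableSet_Iio,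
      ← integral_indicator measurableSet_Iio]
    congr 1; funext y
    by_cases hy : y ∈ Set.Iio r
    · simp [Set.indicator_of_mem hy]; ring
    · simp [Set.indicator_of_notMem hy]
  rw [h2]
  have h3 : ∫ y in (0:ℝ)..r, 2 * a * y / (y ^ 2 + a) ^ 2 = (-a / (r ^ 2 + a)) - (-a / (0 ^ 2 + a)) := by
    refine intervalIntegral.integral_eq_sub_of_hasDerivAt (f := fun y => -a / (y ^ 2 + a)) ?_ ?_
    · intro y _
      have hd : HasDerivAt (fun y : ℝ => y ^ 2 + a) (2 * y) y := by simpa using (hasDerivAt_pow 2 y).add_const a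
      refine ((hasDerivAt_const y (-a)).fun_div hd (by positivity)).congr_deriv ?_
      ring
    · refine Continuous.intervalIntegrable ?_ _ _
      exact Continuous.div (by fun_prop) (by fun_prop) fun y => by positivity
  rw [h3]
  simp
  field_simp
  ring

lemma lowG (U K : Set E2) (hU : IsOpen U) (hUK : U ⊆ K) (hK : IsCompact K) (x : E2) (hx : x ∈ U) :
    ENNReal.ofReal (2 * Real.pi) ≤ Filter.liminf (fun n : ℕ => ENNReal.ofReal
      (∫ y in K, 2 * (1 / ((n:ℝ) + 1)) / (‖x - y‖ ^ 2 + (1 / ((n:ℝ) + 1))) ^ 2)) Filter.atTop := by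
  obtain ⟨r, hr, hrU⟩ := Metric.isOpen_iff.1 hU x hx
  have ht : Filter.Tendsto (fun n : ℕ => ENNReal.ofReal (2 * Real.pi * (r ^ 2 / (r ^ 2 + 1 / ((n:ℝ)+1))))) Filter.atTop
      (nhds (ENNReal.ofReal (2 * Real.pi))) := by
    refine ENNReal.tendsto_ofReal ?_
    have h := tendsto_one_div_add_atTop_nhds_zero_nat (𝕜 := ℝ)
    have h2 := ((tendsto_const_nhds (x := r ^ 2)).div (h.const_add (r ^ 2)) (by positivity)).const_mul (2 * Real.pi)
    have h3 : 2 * Real.pi * (r ^ 2 / (r ^ 2 + 0)) = 2 * Real.pi := by rw [add_zero, div_self (by positivity), mul_one]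
    rw [h3] at h2
    exact h2
  rw [← ht.liminf_eq]
  refine Filter.liminf_le_liminf (Filter.Eventually.of_forall fun n => ENNReal.ofReal_le_ofReal ?_)
  have ha : (0:ℝ) < 1 / ((n:ℝ)+1) := by positivity
  generalize 1 / ((n:ℝ)+1) = a at ha
  rw [← ball_int a r ha hr, ← integral_sub_left_eq_self _ volume x]
  have : ∫ y, (Set.Iio r).indicator (fun t : ℝ => 2 * a / (t ^ 2 + a) ^ 2) ‖x - y‖ = ∫ y in Metric.ball x r, 2 * a / (‖x - y‖ ^ 2 + a) ^ 2 := by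
    rw [← integral_indicator Metric.isOpen_ball.measurableSet]
    congr 1; funext y
    simp only [Set.indicator, Metric.mem_ball, Set.mem_Iio, dist_eq_norm, norm_sub_rev y x]
  rw [this]
  refine setIntegral_mono_set ?_ ?_ ?_
  · have : Continuous fun y => 2 * a / (‖x - y‖ ^ 2 + a) ^ 2 :=
      Continuous.div (by fun_prop) (by fun_prop) fun y => by positivity
    exact this.continuousOn.integrableOn_compact hK
  · exact Filter.Eventually.of_forall fun y => by simp only [Pi.zero_apply]; positivity
  · exact (hrU.trans hUK).eventuallyLE


lemma inner_r (c w : ℝ) (hc : 0 < c) : ∫⁻ r in Set.Ioi (0:ℝ), ENNReal.ofReal (w - c * r) ≤ ENNReal.ofReal ((max w 0) ^ 2 / (2 * c)) := by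
  rcases le_or_gt w 0 with hw | hw
  · rw [setLIntegral_congr_fun (g := fun _ => 0) measurableSet_Ioi]
    · simp
    · intro r hr
      have : 0 < c * r := mul_pos hc hr
      exact ENNReal.ofReal_of_nonpos (by linarith)
  · rw [max_eq_left hw.le]
    have hwc : 0 < w / c := by positivity
    have h1 : ∫⁻ r in Set.Ioi (0:ℝ), ENNReal.ofReal (w - c * r) ≤ ∫⁻ r in Set.Ioc 0 (w / c), ENNReal.ofReal (w - c * r) := by
      rw [← Set.Ioi_inter_Iic, Set.inter_comm, ← Measure.restrict_restrict measurableSet_Iic, ← lintegral_indicator measurableSet_Iic]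
      refine lintegral_mono fun r => ?_
      by_cases hr : r ∈ Set.Iic (w / c)
      · rw [Set.indicator_of_mem hr]
      · rw [Set.indicator_of_notMem hr]
        have : w < c * r := by
          have := lt_of_not_ge (fun h => hr (Set.mem_Iic.2 h))
          rwa [div_lt_iff₀ hc, mul_comm] at this
        rw [ENNReal.ofReal_of_nonpos (by linarith)]
    refine h1.trans (le_of_eq ?_)
    rw [← ofReal_integral_eq_lintegral_ofReal]
    · congr 1
      rw [← intervalIntegral.integral_of_le hwc.le, intervalIntegral.integral_sub (by simp) (Continuous.intervalIntegrable (by fun_prop) _ _),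
        intervalIntegral.integral_const_mul]
      simp
      field_simp
      ring
    · exact (Continuous.integrableOn_Icc (by fun_prop)).mono_set Set.Ioc_subset_Icc_self
    · refine (ae_restrict_iff' measurableSet_Ioc).2 (Filter.Eventually.of_forall fun r hr => ?_)
      have := hr.2
      rw [le_div_iff₀ hc] at this
      simp only [Pi.zero_apply]; linarith

lemma theta_int (c : ℝ) (hc : 0 < c) : ∫⁻ θ in Set.Ioo (-Real.pi) Real.pi, ENNReal.ofReal ((max (Real.cos θ) 0) ^ 2 / (2 * c)) ≤ ENNReal.ofReal (Real.pi / (4 * c)) := by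
  have h1 : ∫⁻ θ in Set.Ioo (-Real.pi) Real.pi, ENNReal.ofReal ((max (Real.cos θ) 0) ^ 2 / (2 * c)) ≤
      ∫⁻ θ in Set.Ioo (-Real.pi) Real.pi, (Set.Ioc (-(Real.pi/2)) (Real.pi/2)).indicator (fun θ => ENNReal.ofReal (Real.cos θ ^ 2 / (2 * c))) θ := by
    refine setLIntegral_mono' measurableSet_Ioo fun θ hθ => ?_
    by_cases h : θ ∈ Set.Ioc (-(Real.pi/2)) (Real.pi/2)
    · rw [Set.indicator_of_mem h, max_eq_left (Real.cos_nonneg_of_mem_Icc ⟨h.1.le, h.2⟩)]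
    · rw [Set.indicator_of_notMem h]
      have : Real.cos θ ≤ 0 := by
        rw [Set.mem_Ioc, not_and_or, not_lt, not_le] at h
        rcases h with h | h
        · rw [← Real.cos_neg]
          exact Real.cos_nonpos_of_pi_div_two_le_of_le (by linarith) (by linarith [hθ.1])
        · exact Real.cos_nonpos_of_pi_div_two_le_of_le h.le (by linarith [hθ.2, Real.pi_pos])
      rw [max_eq_right this]; simp
  refine h1.trans ((setLIntegral_le_lintegral _ _).trans ?_)
  rw [lintegral_indicator measurableSet_Ioc, ← ofReal_integral_eq_lintegral_ofReal]
  · refine ENNReal.ofReal_le_ofReal (le_of_eq ?_)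
    rw [← intervalIntegral.integral_of_le (by linarith [Real.pi_pos]), intervalIntegral.integral_div, integral_cos_sq]
    simp
    field_simp
    ring
  · exact (Continuous.integrableOn_Icc (by fun_prop)).mono_set Set.Ioc_subset_Icc_self
  · exact Filter.Eventually.of_forall fun θ => by simp only [Pi.zero_apply]; positivity

lemma polar_int (c : ℝ) (hc : 0 < c) : ∫⁻ q : ℝ × ℝ, ENNReal.ofReal (q.1 / (q.1 ^ 2 + q.2 ^ 2) - c) ≤ ENNReal.ofReal (Real.pi / (4 * c)) := by
  rw [← lintegral_comp_polarCoord_symm]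
  have h1 : ∀ p ∈ polarCoord.target, ENNReal.ofReal p.1 • ENNReal.ofReal ((polarCoord.symm p).1 / ((polarCoord.symm p).1 ^ 2 + (polarCoord.symm p).2 ^ 2) - c)
      = ENNReal.ofReal (Real.cos p.2 - c * p.1) := by
    intro p hp
    have hp1 : 0 < p.1 := hp.1
    rw [polarCoord_symm_apply, smul_eq_mul, ← ENNReal.ofReal_mul hp1.le]
    congr 1
    simp only
    have : (p.1 * Real.cos p.2) ^ 2 + (p.1 * Real.sin p.2) ^ 2 = p.1 ^ 2 := by
      have := Real.sin_sq_add_cos_sq p.2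
      linear_combination p.1 ^ 2 * this
    rw [this]
    field_simp
  rw [setLIntegral_congr_fun polarCoord.open_target.measurableSet h1, polarCoord_target, Measure.volume_eq_prod, ← Measure.prod_restrict, lintegral_prod_symm _ (by fun_prop)]
  refine (lintegral_mono fun θ => inner_r c (Real.cos θ) hc).trans (theta_int c hc)

lemma bath (K : Set E2) (hK : IsCompact K) (e : E2) (he : ‖e‖ = 1) (a c : ℝ) (ha : 0 < a) (hc : 0 < c) (x : E2) :
    ∫ y in K, inner ℝ e (x - y) / (‖x - y‖ ^ 2 + a) ≤ c * (volume K).toReal + Real.pi / (4 * c) := by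
  obtain ⟨b, rfl⟩ := exists_onb e he
  have hcont : Continuous fun y => inner ℝ (b 0) (x - y) / (‖x - y‖ ^ 2 + a) :=
    Continuous.div (by fun_prop) (by fun_prop) fun y => by positivity
  have hR : 0 ≤ c * (volume K).toReal + Real.pi / (4 * c) := by positivity
  have hpos : ∫ y in K, inner ℝ (b 0) (x - y) / (‖x - y‖ ^ 2 + a) ≤ ∫ y in K, max (inner ℝ (b 0) (x - y) / (‖x - y‖ ^ 2 + a)) 0 :=
    integral_mono (hcont.continuousOn.integrableOn_compact hK) ((hcont.max continuous_const).continuousOn.integrableOn_compact hK)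
      fun y => le_max_left _ _
  have hI : Integrable (fun y => max (inner ℝ (b 0) (x - y) / (‖x - y‖ ^ 2 + a)) (0:ℝ)) (volume.restrict K) :=
    (hcont.max continuous_const).continuousOn.integrableOn_compact hK
  refine hpos.trans ?_
  rw [← ENNReal.ofReal_le_ofReal_iff hR, ofReal_integral_eq_lintegral_ofReal hI
    (Filter.Eventually.of_forall fun y => le_max_right _ _)]
  have hpt : ∀ z : E2, ENNReal.ofReal (max (inner ℝ (b 0) z / (‖z‖ ^ 2 + a)) 0) ≤ ENNReal.ofReal c + ENNReal.ofReal (inner ℝ (b 0) z / ‖z‖ ^ 2 - c) := by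
    intro z
    rcases le_or_gt (inner ℝ (b 0) z) 0 with hz | hz
    · rw [max_eq_right (div_nonpos_of_nonpos_of_nonneg hz (by positivity))]; simp
    · have hz0 : 0 < ‖z‖ := norm_pos_iff.2 (by rintro rfl; simp at hz)
      refine le_trans (ENNReal.ofReal_le_ofReal ?_) ENNReal.ofReal_add_le
      rw [max_eq_left (by positivity)]
      have : inner ℝ (b 0) z / (‖z‖ ^ 2 + a) ≤ inner ℝ (b 0) z / ‖z‖ ^ 2 := by gcongr; linarith
      linarith
  calc _ ≤ ∫⁻ y in K, (ENNReal.ofReal c + ENNReal.ofReal (inner ℝ (b 0) (x - y) / ‖x - y‖ ^ 2 - c)) :=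
        lintegral_mono fun y => hpt (x - y)
    _ = ENNReal.ofReal c * volume K + ∫⁻ y in K, ENNReal.ofReal (inner ℝ (b 0) (x - y) / ‖x - y‖ ^ 2 - c) := by
        rw [lintegral_add_left measurable_const, setLIntegral_const]
    _ ≤ ENNReal.ofReal c * volume K + ∫⁻ y, ENNReal.ofReal (inner ℝ (b 0) (x - y) / ‖x - y‖ ^ 2 - c) := by
        exact add_le_add le_rfl (setLIntegral_le_lintegral _ _)
    _ = ENNReal.ofReal c * volume K + ∫⁻ z, ENNReal.ofReal (inner ℝ (b 0) z / ‖z‖ ^ 2 - c) := by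
        rw [lintegral_sub_left_eq_self (fun z => ENNReal.ofReal (inner ℝ (b 0) z / ‖z‖ ^ 2 - c))]
    _ = ENNReal.ofReal c * volume K + ∫⁻ q : ℝ × ℝ, ENNReal.ofReal (q.1 / (q.1 ^ 2 + q.2 ^ 2) - c) := by
        rw [← (fr_mp b).lintegral_comp_emb (fr b).measurableEmbedding]
        congr 2; funext q
        have hn : ‖fr b (q.1, q.2)‖ ^ 2 = q.1 ^ 2 + q.2 ^ 2 := by
          rw [fr_apply, norm_add_sq_real, inner_smul_left, inner_smul_right, norm_smul, norm_smul]
          simp [b.inner_eq_ite]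
        have hi := fr_inner0 b q.1 q.2
        rw [Prod.mk.eta] at hn hi
        rw [hn, hi]
    _ ≤ ENNReal.ofReal c * volume K + ENNReal.ofReal (Real.pi / (4 * c)) := by gcongr; exact polar_int c hc
    _ = _ := by
        rw [ENNReal.ofReal_add (by positivity) (by positivity), ENNReal.ofReal_mul hc.le, ENNReal.ofReal_toReal hK.measure_lt_top.ne]


lemma flux (U : Set E2) (hU : IsOpen U) (hUb : Bornology.IsBounded U)
    (hfin : μH[1] (frontier U) ≠ ⊤) (A : ℝ) (hA : 0 < A) (hKA : volume (closure U) = ENNReal.ofReal A) (a : ℝ) (ha : 0 < a) :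
    ∫ x in U, (∫ y in closure U, 2 * a / (‖x - y‖ ^ 2 + a) ^ 2) ≤ √(Real.pi * A) * (μH[1] (frontier U)).toReal := by
  have hK : IsCompact (closure U) := hUb.isCompact_closure
  set f : Fin 2 → E2 → ℝ := fun i x => ∫ y in closure U, ker a i (x - y) with hf
  have hkc : ∀ i, Continuous (ker a i) := fun i => (ker_contDiff a ha i).continuous
  have hki : ∀ i x, IntegrableOn (fun y => ker a i (x - y)) (closure U) := fun i x =>
    ((hkc i).comp (by fun_prop : Continuous fun y => x - y)).continuousOn.integrableOn_compact hK
  have hs : 0 < √(Real.pi * A) := Real.sqrt_pos.2 (by positivity)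
  have hss : √(Real.pi * A) ^ 2 = Real.pi * A := Real.sq_sqrt (by positivity)
  have hM : ∀ x, ‖f 0 x • (EuclideanSpace.single 0 1 : E2) + f 1 x • (EuclideanSpace.single 1 1 : E2)‖ ≤ √(Real.pi * A) := by
    intro x
    set Φ := f 0 x • (EuclideanSpace.single 0 1 : E2) + f 1 x • (EuclideanSpace.single 1 1 : E2) with hΦ
    by_cases h0 : Φ = 0
    · rw [h0, norm_zero]; exact hs.le
    have hn : 0 < ‖Φ‖ := norm_pos_iff.2 h0
    set e : E2 := ‖Φ‖⁻¹ • Φ with he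
    have he1 : ‖e‖ = 1 := by rw [he, norm_smul, norm_inv, norm_norm, inv_mul_cancel₀ hn.ne']
    have h1 : inner ℝ e Φ = ‖Φ‖ := by
      rw [he, inner_smul_left, real_inner_self_eq_norm_sq]
      simp; field_simp
    have h2 : inner ℝ e Φ = e 0 * f 0 x + e 1 * f 1 x := by
      rw [PiLp.inner_apply, Fin.sum_univ_two, hΦ]
      simp; ring
    have h3 : inner ℝ e Φ = ∫ y in closure U, inner ℝ e (x - y) / (‖x - y‖ ^ 2 + a) := by
      rw [h2, hf]
      simp only
      rw [← integral_const_mul, ← integral_const_mul, ← integral_add ((hki 0 x).const_mul _) ((hki 1 x).const_mul _)]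
      congr 1; funext y
      rw [PiLp.inner_apply, Fin.sum_univ_two]
      simp [ker]; ring
    have h4 := bath (closure U) hK e he1 a (√(Real.pi * A) / (2 * A)) ha (by positivity) x
    rw [← h3, h1, hKA, ENNReal.toReal_ofReal hA.le] at h4
    refine h4.trans (le_of_eq ?_)
    field_simp
    rw [hss]; ring
  have h := gg_vec U hU hUb hfin (f 0) (f 1) (param_contDiff _ hK _ (ker_contDiff a ha 0)) (param_contDiff _ hK _ (ker_contDiff a ha 1))
    (EuclideanSpace.single 0 1) (EuclideanSpace.single 1 1) (by simp) (by simp) _ hM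
  refine le_trans (le_of_eq ?_) ((le_abs_self _).trans h)
  congr 1; funext x
  have hdi : ∀ i v, IntegrableOn (fun y => fderiv ℝ (ker a i) (x - y) v) (closure U) := fun i v => by
    have hk' : Continuous (fderiv ℝ (ker a i)) := (ker_contDiff a ha i).continuous_fderiv one_ne_zero
    exact (by fun_prop : Continuous fun y => fderiv ℝ (ker a i) (x - y) v).continuousOn.integrableOn_compact hK
  rw [hf]
  simp only
  rw [param_fderiv _ hK _ (ker_contDiff a ha 0), param_fderiv _ hK _ (ker_contDiff a ha 1), ← integral_add (hdi 0 _) (hdi 1 _)]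
  congr 1; funext y
  exact (ker_div a ha _).symm

lemma iso_open (U : Set E2) (hU : IsOpen U) (hUb : Bornology.IsBounded U)
    (hfin : μH[1] (frontier U) ≠ ⊤) (A : ℝ) (hA : 0 < A) (hUA : volume U = ENNReal.ofReal A) (hKA : volume (closure U) = ENNReal.ofReal A) :
    ENNReal.ofReal (2 * √(Real.pi * A)) ≤ μH[1] (frontier U) := by
  have hK : IsCompact (closure U) := hUb.isCompact_closure
  have hs : 0 < √(Real.pi * A) := Real.sqrt_pos.2 (by positivity)
  have hss : √(Real.pi * A) ^ 2 = Real.pi * A := Real.sq_sqrt (by positivity)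
  set m := (μH[1] (frontier U)).toReal with hm
  set G : ℕ → E2 → ℝ := fun n x => ∫ y in closure U, 2 * (1 / ((n:ℝ) + 1)) / (‖x - y‖ ^ 2 + (1 / ((n:ℝ) + 1))) ^ 2 with hG
  have hGc : ∀ n, Continuous (G n) := fun n => by
    refine continuous_parametric_integral_of_continuous ?_ hK
    exact Continuous.div (by fun_prop) (by fun_prop) fun q => by positivity
  have hG0 : ∀ n x, 0 ≤ G n x := fun n x => integral_nonneg fun y => by simp only [Pi.zero_apply]; positivity
  have hb : ∀ n, ∫⁻ x in U, ENNReal.ofReal (G n x) ≤ ENNReal.ofReal (√(Real.pi * A) * m) := fun n => by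
    rw [← ofReal_integral_eq_lintegral_ofReal (((hGc n).continuousOn.integrableOn_compact hK).mono_set subset_closure)
      (Filter.Eventually.of_forall (hG0 n))]
    exact ENNReal.ofReal_le_ofReal (flux U hU hUb hfin A hA hKA _ (by positivity))
  have h1 : ENNReal.ofReal (2 * Real.pi) * ENNReal.ofReal A ≤ ENNReal.ofReal (√(Real.pi * A) * m) := by
    calc _ = ∫⁻ x in U, ENNReal.ofReal (2 * Real.pi) := by rw [setLIntegral_const, hUA]
      _ ≤ ∫⁻ x in U, Filter.liminf (fun n => ENNReal.ofReal (G n x)) Filter.atTop :=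
        setLIntegral_mono' hU.measurableSet fun x hx => lowG U _ hU subset_closure hK x hx
      _ ≤ Filter.liminf (fun n => ∫⁻ x in U, ENNReal.ofReal (G n x)) Filter.atTop :=
        lintegral_liminf_le fun n => (hGc n).measurable.ennreal_ofReal
      _ ≤ Filter.liminf (fun n : ℕ => ENNReal.ofReal (√(Real.pi * A) * m)) Filter.atTop :=
        Filter.liminf_le_liminf (Filter.Eventually.of_forall hb)
      _ = _ := by simp
  have hm0 : 0 ≤ m := ENNReal.toReal_nonneg
  rw [← ENNReal.ofReal_mul (by positivity), ENNReal.ofReal_le_ofReal_iff (by positivity)] at h1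
  rw [← ENNReal.ofReal_toReal hfin]
  refine ENNReal.ofReal_le_ofReal ?_
  refine le_of_mul_le_mul_left ?_ hs
  calc _ = 2 * √(Real.pi * A) ^ 2 := by ring
    _ = 2 * Real.pi * A := by rw [hss]; ring
    _ ≤ _ := h1

lemma vol_zero (G : Set E2) (hG : μH[1] G ≠ ⊤) : volume G = 0 := by
  have h2 : μH[2] G = 0 := by
    rcases Measure.hausdorffMeasure_zero_or_top (show (1:ℝ) < 2 by norm_num) G with h | h
    · exact h
    · exact absurd h hG
  have hl : LipschitzWith 1 (WithLp.ofLp : E2 → (Fin 2 → ℝ)) := PiLp.lipschitzWith_ofLp 2 _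
  have h3 := hl.hausdorffMeasure_image_le (d := 2) (by norm_num) G
  rw [h2, mul_zero, nonpos_iff_eq_zero] at h3
  have h4 : (volume : Measure (Fin 2 → ℝ)) (WithLp.ofLp '' G) = 0 := by
    rw [← hausdorffMeasure_pi_real]; simpa using h3
  have h5 := (PiLp.volume_preserving_ofLp (Fin 2)).measure_preimage_emb
    (MeasurableEquiv.toLp 2 (Fin 2 → ℝ)).symm.measurableEmbedding (WithLp.ofLp '' G)
  rw [h4] at h5
  exact measure_mono_null (Set.subset_preimage_image _ _) h5

lemma iso (S : Set E2) (hSb : Bornology.IsBounded S) (A : ℝ) (hA : 0 < A) (hSA : volume S = ENNReal.ofReal A) :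
    ENNReal.ofReal (2 * √(Real.pi * A)) ≤ μH[1] (frontier S) := by
  by_cases hfin : μH[1] (frontier S) = ⊤
  · rw [hfin]; exact le_top
  have hv := vol_zero _ hfin
  have hsub : frontier (interior S) ⊆ frontier S := frontier_interior_subset
  have hU : volume (interior S) = ENNReal.ofReal A := by
    refine le_antisymm (hSA ▸ measure_mono interior_subset) ?_
    rw [← hSA]
    calc volume S ≤ volume (interior S ∪ frontier S) := measure_mono fun x hx => by
          by_cases h : x ∈ interior S
          · exact Or.inl h
          · exact Or.inr ⟨subset_closure hx, h⟩
      _ ≤ volume (interior S) + volume (frontier S) := measure_union_le _ _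
      _ = _ := by rw [hv, add_zero]
  have hK : volume (closure (interior S)) = ENNReal.ofReal A := by
    refine le_antisymm ?_ (hU ▸ measure_mono subset_closure)
    rw [closure_eq_self_union_frontier]
    refine (measure_union_le _ _).trans ?_
    rw [hU, measure_mono_null hsub hv, add_zero]
  exact (iso_open (interior S) isOpen_interior (hSb.subset interior_subset) (ne_top_of_le_ne_top hfin (measure_mono hsub)) A hA hU hK).trans
    (measure_mono hsub)

lemma circ (c : E2) (r : ℝ) (hr : 0 < r) : μH[1] (Metric.sphere c r) ≤ ENNReal.ofReal (2 * Real.pi * r) := by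
  set γ : ℝ → E2 := fun θ => c + r • !₂[Real.cos θ, Real.sin θ] with hγ
  have hlip : LipschitzWith r.toNNReal γ := by
    refine LipschitzWith.of_dist_le_mul fun s t => ?_
    rw [hγ]
    simp only
    rw [dist_add_left, dist_smul₀, Real.coe_toNNReal r hr.le, Real.norm_of_nonneg hr.le]
    refine mul_le_mul_of_nonneg_left ?_ hr.le
    rw [EuclideanSpace.dist_eq, Fin.sum_univ_two, Real.dist_eq, Real.dist_eq, Real.dist_eq, Real.sqrt_le_left (abs_nonneg _)]
    simp only [sq_abs]
    simp
    have h1 : (Real.cos s - Real.cos t) ^ 2 + (Real.sin s - Real.sin t) ^ 2 = 2 * (1 - Real.cos (s - t)) := by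
      rw [Real.cos_sub]
      linear_combination Real.sin_sq_add_cos_sq s + Real.sin_sq_add_cos_sq t
    rw [h1]
    have := Real.one_sub_sq_div_two_le_cos (x := s - t)
    linarith
  have hsub : Metric.sphere c r ⊆ γ '' Set.Icc (-Real.pi) Real.pi := by
    intro x hx
    set z : ℂ := ⟨x 0 - c 0, x 1 - c 1⟩ with hz
    have hzr : ‖z‖ = r := by
      have : dist x c = r := hx
      rw [EuclideanSpace.dist_eq, Fin.sum_univ_two, Real.dist_eq, Real.dist_eq, sq_abs, sq_abs] at this
      rw [Complex.norm_eq_sqrt_sq_add_sq, ← this]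
    refine ⟨z.arg, ⟨(Complex.neg_pi_lt_arg z).le, Complex.arg_le_pi z⟩, ?_⟩
    have h0 := Complex.norm_mul_cos_arg z
    have h1 := Complex.norm_mul_sin_arg z
    rw [hzr] at h0 h1
    ext i
    fin_cases i
    · simp [hγ, h0]; simp [hz]
    · simp [hγ, h1]; simp [hz]
  calc _ ≤ μH[1] (γ '' Set.Icc (-Real.pi) Real.pi) := measure_mono hsub
    _ ≤ _ := hlip.hausdorffMeasure_image_le zero_le_one _
    _ = _ := by
      rw [hausdorffMeasure_real, Real.volume_Icc, ENNReal.rpow_one]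
      rw [show ((r.toNNReal : NNReal) : ENNReal) = ENNReal.ofReal r from rfl, ← ENNReal.ofReal_mul hr.le]
      congr 1; ring

theorem stmt_9 (S : Set (EuclideanSpace ℝ (Fin 2))) (hSb : Bornology.IsBounded S)
    (hSm : MeasurableSet S) (A : ℝ) (hA : 0 < A)
    (hSA : volume S = ENNReal.ofReal A) :
    ENNReal.ofReal (2 * Real.sqrt (Real.pi * A)) ≤ μH[1] (frontier S) ∧
    (∀ c : EuclideanSpace ℝ (Fin 2), S = Metric.ball c (Real.sqrt (A / Real.pi)) →
      μH[1] (frontier S) = ENNReal.ofReal (2 * Real.sqrt (Real.pi * A))) := by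
  have h := iso S hSb A hA hSA
  refine ⟨h, fun c hc => le_antisymm ?_ h⟩
  have hr : 0 < √(A / Real.pi) := Real.sqrt_pos.2 (by positivity)
  rw [hc, frontier_ball c hr.ne']
  refine (circ c _ hr).trans (ENNReal.ofReal_le_ofReal (le_of_eq ?_))
  have h2 : √(Real.pi * A) = Real.pi * √(A / Real.pi) := by
    rw [Real.sqrt_eq_iff_mul_self_eq (by positivity) (by positivity)]
    have := Real.mul_self_sqrt (show 0 ≤ A / Real.pi by positivity)
    symm
    calc _ = Real.pi * Real.pi * (√(A / Real.pi) * √(A / Real.pi)) := by ring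
      _ = _ := by rw [this]; field_simp
  rw [h2]; ring
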